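/- Let N ≥ 3, α ∈ [0,2), β > 0, b, c ∈ ℝ, and let λ > 0 be such that ((N−2)²/8) t^{−2} + (c − 1 − ((α−b)/2)(α−2+N)) t^{α−2} + λ > 0 for every t > 0. Then for every u ∈ C_c^∞(ℝ^N \ {0}; ℂ): ∫_{ℝ^N} |x|^{α−2} |u|² dx ≤ Re 𝔞(u,u) and ∫_{ℝ^N} |x|^β |u|² dx ≤ Re 𝔞(u,u). -/

import Mathlib

open MeasureTheory Real

noncomputable section

/-- The `i`-th partial derivative of a complex-valued function on `ℝ^N`. -/
def pdC {N : ℕ} (i : Fin N) (f : EuclideanSpace ℝ (Fin N) → ℂ)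
    (x : EuclideanSpace ℝ (Fin N)) : ℂ :=
  fderiv ℝ f x (EuclideanSpace.single i 1)

/-- Smooth compactly supported functions whose support avoids the origin. -/
def IsTestAway0 {N : ℕ} (u : EuclideanSpace ℝ (Fin N) → ℂ) : Prop :=
  ContDiff ℝ (⊤ : ℕ∞) u ∧ HasCompactSupport u ∧ (0 : EuclideanSpace ℝ (Fin N)) ∉ tsupport u

/-- The quadratic form `𝔞(u,u)` associated with the operator `A_{b,c}`, with shift `l`. -/
def formA {N : ℕ} (α β b c l : ℝ) (u : EuclideanSpace ℝ (Fin N) → ℂ) : ℂ :=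
  ∫ x, (((1 + ‖x‖ ^ α : ℝ) : ℂ) * ((∑ i, ‖pdC i u x‖ ^ 2 : ℝ) : ℂ)
    + (((α - b) * ‖x‖ ^ (α - 2) : ℝ) : ℂ) *
        ((∑ i, (x i : ℂ) * pdC i u x) * (starRingEnd ℂ) (u x))
    + ((c * ‖x‖ ^ (α - 2) + ‖x‖ ^ β + l : ℝ) : ℂ) * ((‖u x‖ ^ 2 : ℝ) : ℂ))

section Divergence

variable {N : ℕ}

/-- The integral of a directional derivative of a compactly supported `C¹` function vanishes. -/
lemma integral_fderiv_apply_eq_zero {f : EuclideanSpace ℝ (Fin N) → ℝ}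
    (hf : ContDiff ℝ 1 f) (hc : HasCompactSupport f) (v : EuclideanSpace ℝ (Fin N)) :
    ∫ x, fderiv ℝ f x v = 0 := by
  have hd : Continuous fun x => fderiv ℝ f x v :=
    (hf.continuous_fderiv (by norm_num)).clm_apply continuous_const
  have hdc : HasCompactSupport fun x => fderiv ℝ f x v := hc.fderiv_apply ℝ v
  have h := integral_mul_fderiv_eq_neg_fderiv_mul_of_integrable
    (μ := (volume : Measure (EuclideanSpace ℝ (Fin N)))) (𝕜 := ℝ)
    (f := fun _ => (1 : ℝ)) (g := f) (v := v)
    (by simp) (by simpa using hd.integrable_of_hasCompactSupport hdc)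
    (by simpa using hf.continuous.integrable_of_hasCompactSupport hc)
    (fun _ _ => differentiableAt_const _) (fun x _ => hf.differentiable (by norm_num) x)
  simpa using h

/-- The divergence theorem for the vector field `x ↦ g x • x`. -/
lemma integral_dim_mul_add_fderiv_self {g : EuclideanSpace ℝ (Fin N) → ℝ}
    (hg : ContDiff ℝ 1 g) (hc : HasCompactSupport g) :
    ∫ x, ((N : ℝ) * g x + fderiv ℝ g x x) = 0 := by
  have hcoord : ∀ i : Fin N, ContDiff ℝ 1 fun x : EuclideanSpace ℝ (Fin N) => x i :=
    fun i => (EuclideanSpace.proj (𝕜 := ℝ) i).contDiff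
  have hw : ∀ i : Fin N, ContDiff ℝ 1 fun x : EuclideanSpace ℝ (Fin N) => x i * g x :=
    fun i => (hcoord i).mul hg
  have hwc : ∀ i : Fin N, HasCompactSupport fun x : EuclideanSpace ℝ (Fin N) => x i * g x :=
    fun i => hc.mul_left
  have hsum : ∀ x : EuclideanSpace ℝ (Fin N), (N : ℝ) * g x + fderiv ℝ g x x
      = ∑ i, fderiv ℝ (fun y : EuclideanSpace ℝ (Fin N) => y i * g y) x
          (EuclideanSpace.single i 1) := by
    intro x
    have hi : ∀ i : Fin N, fderiv ℝ (fun y : EuclideanSpace ℝ (Fin N) => y i * g y) x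
        (EuclideanSpace.single i 1) = g x + x i * fderiv ℝ g x (EuclideanSpace.single i 1) := by
      intro i
      have h1 : HasFDerivAt (fun y : EuclideanSpace ℝ (Fin N) => y i)
          (EuclideanSpace.proj (𝕜 := ℝ) i) x := (EuclideanSpace.proj (𝕜 := ℝ) i).hasFDerivAt
      have h2 := ((hg.differentiable (by norm_num)) x).hasFDerivAt
      rw [(h1.fun_mul h2).fderiv]
      simp
      ring
    have hx : fderiv ℝ g x x = ∑ i, x i * fderiv ℝ g x (EuclideanSpace.single i 1) := by
      conv_lhs => arg 2; rw [← (EuclideanSpace.basisFun (Fin N) ℝ).sum_repr x]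
      simp [map_sum]
    simp only [hi, Finset.sum_add_distrib, hx]
    simp
  simp_rw [hsum]
  rw [integral_finsetSum]
  · exact Finset.sum_eq_zero fun i _ => integral_fderiv_apply_eq_zero (hw i) (hwc i) _
  · intro i _
    exact (((hw i).continuous_fderiv (by norm_num)).clm_apply
      continuous_const).integrable_of_hasCompactSupport ((hwc i).fderiv_apply ℝ _)

end Divergence

section TestFunctions

variable {N : ℕ} {u : EuclideanSpace ℝ (Fin N) → ℂ}

/-- `Re (x · ∇u) ū` -/
def radialRe (u : EuclideanSpace ℝ (Fin N) → ℂ) (x : EuclideanSpace ℝ (Fin N)) : ℝ :=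
  ((∑ i, (x i : ℂ) * pdC i u x) * (starRingEnd ℂ) (u x)).re

lemma sum_coord_mul_pdC (u : EuclideanSpace ℝ (Fin N) → ℂ) (x : EuclideanSpace ℝ (Fin N)) :
    ∑ i, (x i : ℂ) * pdC i u x = fderiv ℝ u x x := by
  conv_rhs => arg 2; rw [← (EuclideanSpace.basisFun (Fin N) ℝ).sum_repr x]
  simp [map_sum, pdC]

lemma continuous_rpow_norm_smul {E : Type*} [NormedAddCommGroup E] [NormedSpace ℝ E]
    {f : EuclideanSpace ℝ (Fin N) → E} (hf : Continuous f)
    (h0 : (0 : EuclideanSpace ℝ (Fin N)) ∉ tsupport f) (s : ℝ) :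
    Continuous fun x => ‖x‖ ^ s • f x := by
  refine continuous_of_tsupport fun x hx => ?_
  have hx0 : x ≠ 0 := by
    rintro rfl
    exact h0 (closure_mono (Function.support_smul_subset_right _ _) hx)
  exact (continuousAt_id.norm.rpow_const (Or.inl (norm_ne_zero_iff.2 hx0))).smul hf.continuousAt

lemma integrable_rpow_norm_smul {E : Type*} [NormedAddCommGroup E] [NormedSpace ℝ E]
    {f : EuclideanSpace ℝ (Fin N) → E} (hf : Continuous f) (hc : HasCompactSupport f)
    (h0 : (0 : EuclideanSpace ℝ (Fin N)) ∉ tsupport f) (s : ℝ) :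
    Integrable fun x => ‖x‖ ^ s • f x :=
  (continuous_rpow_norm_smul hf h0 s).integrable_of_hasCompactSupport hc.smul_left

lemma tsupport_normSq_subset (u : EuclideanSpace ℝ (Fin N) → ℂ) :
    tsupport (fun x => ‖u x‖ ^ 2) ⊆ tsupport u :=
  closure_mono fun x hx h => hx (by simp [h])

/-- The derivative of `‖x‖ ^ s * ‖u x‖ ^ 2` in the radial direction. -/
lemma fderiv_rpow_norm_mul_normSq_self (hu : IsTestAway0 u) (s : ℝ)
    (x : EuclideanSpace ℝ (Fin N)) :
    fderiv ℝ (fun y => ‖y‖ ^ s * ‖u y‖ ^ 2) x x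
      = s * (‖x‖ ^ s * ‖u x‖ ^ 2) + 2 * (‖x‖ ^ s * radialRe u x) := by
  rcases eq_or_ne x 0 with rfl | hx
  · simp [radialRe, image_eq_zero_of_notMem_tsupport hu.2.2]
  · have hn : ‖x‖ ≠ 0 := norm_ne_zero_iff.2 hx
    have hnorm := ((contDiffAt_norm ℝ hx (n := 1)).differentiableAt (by norm_num)).hasFDerivAt
    have hself : fderiv ℝ (fun y : EuclideanSpace ℝ (Fin N) => ‖y‖) x x = ‖x‖ :=
      ((contDiffAt_norm ℝ hx (n := 1)).differentiableAt (by norm_num)).fderiv_norm_self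
    have h1 := hnorm.rpow_const (p := s) (Or.inl hn)
    have h2 := ((hu.1.differentiable (by simp)) x).hasFDerivAt.norm_sq
    rw [(h1.fun_mul h2).fderiv]
    have hpow : ‖x‖ ^ (s - 1) * ‖x‖ = ‖x‖ ^ s := by
      rw [rpow_sub_one hn, div_mul_cancel₀ _ hn]
    have hin : inner ℝ (u x) (fderiv ℝ u x x) = radialRe u x := by
      rw [radialRe, sum_coord_mul_pdC, Complex.inner]
    simp [hself, hin]
    linear_combination s * ‖u x‖ ^ 2 * hpow

lemma integral_radialRe (hu : IsTestAway0 u) (s : ℝ) :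
    ∫ x, (2 * (‖x‖ ^ s * radialRe u x) + ((N : ℝ) + s) * (‖x‖ ^ s * ‖u x‖ ^ 2)) = 0 := by
  have hg : ContDiff ℝ 1 fun x => ‖x‖ ^ s * ‖u x‖ ^ 2 := by
    refine contDiff_iff_contDiffAt.2 fun x => ?_
    by_cases hx : x ∈ tsupport fun x => ‖x‖ ^ s * ‖u x‖ ^ 2
    swap
    · exact contDiffAt_const.congr_of_eventuallyEq (notMem_tsupport_iff_eventuallyEq.1 hx)
    have hx0 : x ≠ 0 := by
      rintro rfl
      exact hu.2.2 (tsupport_normSq_subset u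
        (closure_mono (Function.support_mul_subset_right _ _) hx))
    exact ((contDiffAt_norm ℝ hx0).rpow_const_of_ne (norm_ne_zero_iff.2 hx0)).mul
      ((hu.1.of_le (by simp)).contDiffAt.norm_sq ℝ)
  have hP : HasCompactSupport fun x => ‖u x‖ ^ 2 :=
    hu.2.1.of_isClosed_subset (isClosed_tsupport _) (tsupport_normSq_subset u)
  rw [← integral_dim_mul_add_fderiv_self hg hP.mul_left]
  refine integral_congr_ae (.of_forall fun x => ?_)
  simp only [fderiv_rpow_norm_mul_normSq_self hu]
  ring

/-- The pointwise inequality behind Hardy's inequality, by completing the square. -/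
lemma hardy_pointwise (u : EuclideanSpace ℝ (Fin N) → ℂ) {x : EuclideanSpace ℝ (Fin N)}
    (hx : x ≠ 0) (k : ℝ) :
    0 ≤ ∑ i, ‖pdC i u x‖ ^ 2 + 2 * k * (‖x‖ ^ (-2 : ℝ) * radialRe u x)
      + k ^ 2 * (‖x‖ ^ (-2 : ℝ) * ‖u x‖ ^ 2) := by
  have hn : ‖x‖ ≠ 0 := norm_ne_zero_iff.2 hx
  have hpow : ‖x‖ ^ (-2 : ℝ) = (‖x‖ ^ 2)⁻¹ := by
    rw [rpow_neg (norm_nonneg _), rpow_two]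
  set t : ℝ := (‖x‖ ^ 2)⁻¹ with ht
  have hsq : ∑ i, x i ^ 2 = ‖x‖ ^ 2 := (EuclideanSpace.real_norm_sq_eq x).symm
  have hQ : radialRe u x = ∑ i, x i * (pdC i u x * (starRingEnd ℂ) (u x)).re := by
    simp only [radialRe, Finset.sum_mul, Complex.re_sum, mul_assoc, Complex.re_ofReal_mul]
  have hexp : ∀ i, ‖pdC i u x + ((k * t * x i : ℝ) : ℂ) * u x‖ ^ 2 = ‖pdC i u x‖ ^ 2
      + 2 * k * t * (x i * (pdC i u x * (starRingEnd ℂ) (u x)).re)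
      + k ^ 2 * t ^ 2 * ‖u x‖ ^ 2 * x i ^ 2 := by
    intro i
    simp only [Complex.sq_norm, Complex.normSq_apply, Complex.add_re, Complex.add_im,
      Complex.mul_re, Complex.mul_im, Complex.ofReal_re, Complex.ofReal_im, Complex.conj_re,
      Complex.conj_im]
    ring
  have h : 0 ≤ ∑ i, ‖pdC i u x + ((k * t * x i : ℝ) : ℂ) * u x‖ ^ 2 :=
    Finset.sum_nonneg fun i _ => sq_nonneg _
  simp only [hexp, Finset.sum_add_distrib, ← Finset.mul_sum, hsq, ← hQ] at h
  have htx : t * ‖x‖ ^ 2 = 1 := inv_mul_cancel₀ (pow_ne_zero 2 hn)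
  rw [hpow]
  linear_combination h + k ^ 2 * t * ‖u x‖ ^ 2 * htx

end TestFunctions

theorem stmt4 (N : ℕ) (hN : 3 ≤ N) (α β b c l : ℝ) (hα0 : 0 ≤ α) (hα2 : α < 2) (hβ : 0 < β)
    (hl : 0 < l)
    (hlpos : ∀ t : ℝ, 0 < t →
      0 < ((N : ℝ) - 2) ^ 2 / 8 * t ^ (-2 : ℝ)
        + (c - 1 - (α - b) / 2 * (α - 2 + N)) * t ^ (α - 2) + l)
    (u : EuclideanSpace ℝ (Fin N) → ℂ) (hu : IsTestAway0 u) :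
    (∫ x, ‖x‖ ^ (α - 2) * ‖u x‖ ^ 2) ≤ (formA α β b c l u).re ∧
    (∫ x, ‖x‖ ^ β * ‖u x‖ ^ 2) ≤ (formA α β b c l u).re := by
  obtain ⟨hsm, hcs, h0⟩ := hu
  have hcont := hsm.continuous
  have hu0 : u 0 = 0 := image_eq_zero_of_notMem_tsupport h0
  have hdu : ∀ i, Continuous (pdC i u) := fun i =>
    (hsm.continuous_fderiv (by simp)).clm_apply continuous_const
  have hdsupp : ∀ i x, x ∉ tsupport u → pdC i u x = 0 := fun i x hx => by
    have := image_eq_zero_of_notMem_tsupport (fun h => hx (tsupport_fderiv_subset ℝ h))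
    simp [pdC, this]
  have hint : ∀ {E : Type} [NormedAddCommGroup E] [NormedSpace ℝ E]
      {f : EuclideanSpace ℝ (Fin N) → E}, Continuous f → (∀ x, x ∉ tsupport u → f x = 0) →
      ∀ s : ℝ, Integrable fun x => ‖x‖ ^ s • f x := by
    intro E _ _ f hf hz s
    have hsub : tsupport f ⊆ tsupport u :=
      closure_minimal (fun x hx => by_contra fun h => hx (hz x h)) (isClosed_tsupport _)
    exact integrable_rpow_norm_smul hf
      (hcs.of_isClosed_subset (isClosed_tsupport _) hsub) (fun h => h0 (hsub h)) s
  have hz : ∀ x, x ∉ tsupport u → u x = 0 := fun x hx => image_eq_zero_of_notMem_tsupport hx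
  have hP : ∀ s : ℝ, Integrable fun x => ‖x‖ ^ s * ‖u x‖ ^ 2 :=
    hint (f := fun x => ‖u x‖ ^ 2) (by fun_prop) fun x hx => by simp [hz x hx]
  have hG : ∀ s : ℝ, Integrable fun x => ‖x‖ ^ s * ∑ i, ‖pdC i u x‖ ^ 2 :=
    hint (f := fun x => ∑ i, ‖pdC i u x‖ ^ 2) (by fun_prop) fun x hx => by
      simp [hdsupp _ x hx]
  have hH : ∀ s : ℝ, Integrable fun x =>
      ‖x‖ ^ s • ((∑ i, (x i : ℂ) * pdC i u x) * (starRingEnd ℂ) (u x)) :=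
    hint (by fun_prop) fun x hx => by simp [hz x hx]
  have hQ : ∀ s : ℝ, Integrable fun x => ‖x‖ ^ s * radialRe u x := fun s => by
    simpa [radialRe] using (hH s).re
  have hform : (formA α β b c l u).re = ∫ x, ((1 + ‖x‖ ^ α) * ∑ i, ‖pdC i u x‖ ^ 2
      + (α - b) * (‖x‖ ^ (α - 2) * radialRe u x)
      + (c * ‖x‖ ^ (α - 2) + ‖x‖ ^ β + l) * ‖u x‖ ^ 2) := by
    have hc : Integrable fun x => (((1 + ‖x‖ ^ α : ℝ) : ℂ) * ((∑ i, ‖pdC i u x‖ ^ 2 : ℝ) : ℂ)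
        + (((α - b) * ‖x‖ ^ (α - 2) : ℝ) : ℂ) *
          ((∑ i, (x i : ℂ) * pdC i u x) * (starRingEnd ℂ) (u x))
        + ((c * ‖x‖ ^ (α - 2) + ‖x‖ ^ β + l : ℝ) : ℂ) * ((‖u x‖ ^ 2 : ℝ) : ℂ)) := by
      have h1 := ((hG 0).add (hG α)).ofReal (𝕜 := ℂ)
      have h2 := (hH (α - 2)).const_mul ((α - b : ℝ) : ℂ)
      have h3 := ((((hP (α - 2)).const_mul c).add (hP β)).add
        ((hP 0).const_mul l)).ofReal (𝕜 := ℂ)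
      refine ((h1.add h2).add h3).congr (.of_forall fun x => ?_)
      simp
      ring
    have hre := integral_re hc
    simp only [RCLike.re_eq_complex_re] at hre
    rw [formA, ← hre]
    refine integral_congr_ae (.of_forall fun x => ?_)
    simp only [Complex.add_re, Complex.re_ofReal_mul, radialRe, Complex.ofReal_re, mul_assoc]
  have hJ : Integrable fun x => ((1 + ‖x‖ ^ α) * ∑ i, ‖pdC i u x‖ ^ 2
      + (α - b) * (‖x‖ ^ (α - 2) * radialRe u x)
      + (c * ‖x‖ ^ (α - 2) + ‖x‖ ^ β + l) * ‖u x‖ ^ 2) := by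
    refine ((((hG 0).add (hG α)).add ((hQ (α - 2)).const_mul (α - b))).add
      ((((hP (α - 2)).const_mul c).add (hP β)).add ((hP 0).const_mul l))).congr
      (.of_forall fun x => ?_)
    simp
    ring
  have hF : ∀ s : ℝ, Integrable fun x =>
      (2 * (‖x‖ ^ s * radialRe u x) + ((N : ℝ) + s) * (‖x‖ ^ s * ‖u x‖ ^ 2)) := fun s =>
    ((hQ s).const_mul 2).add ((hP s).const_mul _)
  have hpt : ∀ x : EuclideanSpace ℝ (Fin N),
      ‖x‖ ^ (α - 2) * ‖u x‖ ^ 2 + ‖x‖ ^ β * ‖u x‖ ^ 2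
      ≤ ((1 + ‖x‖ ^ α) * ∑ i, ‖pdC i u x‖ ^ 2 + (α - b) * (‖x‖ ^ (α - 2) * radialRe u x)
          + (c * ‖x‖ ^ (α - 2) + ‖x‖ ^ β + l) * ‖u x‖ ^ 2)
        - (α - b) / 2 * (2 * (‖x‖ ^ (α - 2) * radialRe u x)
          + ((N : ℝ) + (α - 2)) * (‖x‖ ^ (α - 2) * ‖u x‖ ^ 2))
        + ((N : ℝ) - 2) / 2 * (2 * (‖x‖ ^ (-2 : ℝ) * radialRe u x)
          + ((N : ℝ) + (-2)) * (‖x‖ ^ (-2 : ℝ) * ‖u x‖ ^ 2)) := by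
    intro x
    have hG0 : 0 ≤ ∑ i, ‖pdC i u x‖ ^ 2 := Finset.sum_nonneg fun i _ => sq_nonneg _
    have hαG : 0 ≤ ‖x‖ ^ α * ∑ i, ‖pdC i u x‖ ^ 2 :=
      mul_nonneg (rpow_nonneg (norm_nonneg _) _) hG0
    rcases eq_or_ne x 0 with rfl | hx
    · simp only [radialRe, hu0, map_zero, mul_zero, Complex.zero_re, norm_zero, add_zero,
        ne_eq, OfNat.ofNat_ne_zero, not_false_eq_true, zero_pow, sub_zero] at hαG ⊢
      linarith
    · have hhardy := hardy_pointwise u hx (((N : ℝ) - 2) / 2)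
      have hpos := mul_nonneg (hlpos ‖x‖ (norm_pos_iff.2 hx)).le (sq_nonneg ‖u x‖)
      have hrest : 0 ≤ ((N : ℝ) - 2) ^ 2 / 8 * (‖x‖ ^ (-2 : ℝ) * ‖u x‖ ^ 2) := by positivity
      linear_combination hhardy + hpos + hrest + hαG
  have hsum : (∫ x, ‖x‖ ^ (α - 2) * ‖u x‖ ^ 2) + (∫ x, ‖x‖ ^ β * ‖u x‖ ^ 2)
      ≤ (formA α β b c l u).re := by
    have h := integral_mono ((hP (α - 2)).add (hP β))
      ((hJ.sub ((hF (α - 2)).const_mul ((α - b) / 2))).add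
        ((hF (-2)).const_mul (((N : ℝ) - 2) / 2))) hpt
    rw [integral_add' (hP _) (hP _), integral_add' (hJ.sub ((hF _).const_mul _))
      ((hF _).const_mul _), integral_sub' hJ ((hF _).const_mul _), integral_const_mul,
      integral_const_mul, integral_radialRe ⟨hsm, hcs, h0⟩, integral_radialRe ⟨hsm, hcs, h0⟩,
      mul_zero, mul_zero, sub_zero, add_zero, ← hform] at h
    exact h
  have hnn : ∀ s : ℝ, 0 ≤ ∫ x, ‖x‖ ^ s * ‖u x‖ ^ 2 := fun s =>
    integral_nonneg fun x => by positivity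
  exact ⟨by linarith [hnn β], by linarith [hnn (α - 2)]⟩
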